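/- Let h₁(x) = 217019x² + 87907368140554183100162x + 4508281300847688731169319769769841835444, h₂(x) = 37258218541488534910719399x² + 246529569778532375140876985021306849541294312x + 14635567009082568185596461891292367332677180975427256879233264, h₃(x) = 2223585235421468919x² + 274156098050901691661379937349434622x + 8443409213944751989643951279235627283533452107433272, h₄(x) = 13385859493702x³ + 225702085730490664288660568855789598873301353168x + 16436156522418265669179020769359057896808189915554213257292620245. For every real number t₀ with 2.65·10³⁹ < t₀ < 3.42·10³⁹, the degree-12 real polynomial h(t₀, x) = h₁(x)⁵·h₂(x) − t₀·h₃(x)³·h₄(x) has only real roots, i.e., it splits over ℝ (equivalently, all of its complex roots are real). -/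

import Mathlib

open Polynomial

noncomputable def h1 : Polynomial ℝ :=
  C 217019 * X ^ 2 + C 87907368140554183100162 * X +
    C 4508281300847688731169319769769841835444

noncomputable def h2 : Polynomial ℝ :=
  C 37258218541488534910719399 * X ^ 2 +
    C 246529569778532375140876985021306849541294312 * X +
    C 14635567009082568185596461891292367332677180975427256879233264

noncomputable def h3 : Polynomial ℝ :=
  C 2223585235421468919 * X ^ 2 +
    C 274156098050901691661379937349434622 * X +
    C 8443409213944751989643951279235627283533452107433272

noncomputable def h4 : Polynomial ℝ :=
  C 13385859493702 * X ^ 3 +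
    C 225702085730490664288660568855789598873301353168 * X +
    C 16436156522418265669179020769359057896808189915554213257292620245

/-- The specialization `h(t₀, x) = h₁(x)⁵ h₂(x) − t₀ · h₃(x)³ h₄(x)` as a real polynomial. -/
noncomputable def h (t₀ : ℝ) : Polynomial ℝ := h1 ^ 5 * h2 - C t₀ * (h3 ^ 3 * h4)

/-- A real polynomial of degree `n` alternating in sign along `n + 1` increasing points splits. -/
theorem splits_of_alternating (n : ℕ) (p : ℝ[X]) (hd : p.natDegree = n) (x : Fin (n + 1) → ℝ)
    (hx : ∀ i : Fin n, x i.castSucc < x i.succ)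
    (hs : ∀ i : Fin n, p.eval (x i.castSucc) * p.eval (x i.succ) < 0) : p.Splits := by
  rcases Nat.eq_zero_or_pos n with h0 | hn
  · exact Splits.of_natDegree_le_one (by omega)
  have hp : p ≠ 0 := by
    rintro rfl
    simp at hd
    omega
  have hxm : StrictMono x := Fin.strictMono_iff_lt_succ.2 hx
  have key : ∀ i : Fin n, ∃ r, x i.castSucc < r ∧ r < x i.succ ∧ p.eval r = 0 := by
    intro i
    have hc : ContinuousOn (fun y => p.eval y) (Set.Icc (x i.castSucc) (x i.succ)) :=
      p.continuous.continuousOn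
    rcases mul_neg_iff.1 (hs i) with ⟨ha, hb⟩ | ⟨ha, hb⟩
    · obtain ⟨r, hr, h⟩ := intermediate_value_Ioo' (hx i).le hc ⟨hb, ha⟩
      exact ⟨r, hr.1, hr.2, h⟩
    · obtain ⟨r, hr, h⟩ := intermediate_value_Ioo (hx i).le hc ⟨ha, hb⟩
      exact ⟨r, hr.1, hr.2, h⟩
  choose r hr1 hr2 hr3 using key
  have hrm : StrictMono r := by
    intro i j hij
    refine (hr2 i).trans_le (le_trans (hxm.monotone ?_) (hr1 j).le)
    simp only [Fin.le_def, Fin.lt_def, Fin.val_succ, Fin.val_castSucc] at *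
    omega
  have hsub : Finset.univ.image r ⊆ p.roots.toFinset := by
    intro y hy
    obtain ⟨i, -, rfl⟩ := Finset.mem_image.1 hy
    simpa [hp] using hr3 i
  have hcard := Finset.card_le_card hsub
  rw [Finset.card_image_of_injective _ hrm.injective, Finset.card_univ, Fintype.card_fin] at hcard
  have h2 := p.roots.toFinset_card_le
  have h3 := p.card_roots'
  exact splits_iff_card_roots.2 (by omega)

theorem natDegree_h (t : ℝ) : (h t).natDegree = 12 := by
  have d1 : h1.natDegree = 2 := by unfold h1; compute_degree!
  have d2 : h2.natDegree = 2 := by unfold h2; compute_degree!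
  have d3 : h3.natDegree = 2 := by unfold h3; compute_degree!
  have d4 : h4.natDegree = 3 := by unfold h4; compute_degree!
  have n1 : h1 ≠ 0 := by rintro e; simp [e] at d1
  have n2 : h2 ≠ 0 := by rintro e; simp [e] at d2
  have dA : (h1 ^ 5 * h2).natDegree = 12 := by
    rw [natDegree_mul (pow_ne_zero _ n1) n2, natDegree_pow, d1, d2]
  have dB : (C t * (h3 ^ 3 * h4)).natDegree ≤ 9 := by
    refine (natDegree_C_mul_le _ _).trans (natDegree_mul_le.trans ?_)
    rw [natDegree_pow, d3, d4]
  unfold h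
  rw [natDegree_sub_eq_left_of_natDegree_lt (by omega), dA]

theorem eval_h (t x : ℝ) : (h t).eval x =
    (217019 * x ^ 2 + 87907368140554183100162 * x +
      4508281300847688731169319769769841835444) ^ 5 *
    (37258218541488534910719399 * x ^ 2 +
      246529569778532375140876985021306849541294312 * x +
      14635567009082568185596461891292367332677180975427256879233264) -
    t * ((2223585235421468919 * x ^ 2 + 274156098050901691661379937349434622 * x +
      8443409213944751989643951279235627283533452107433272) ^ 3 *
    (13385859493702 * x ^ 3 + 225702085730490664288660568855789598873301353168 * x +
      16436156522418265669179020769359057896808189915554213257292620245)) := by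
  simp only [h, h1, h2, h3, h4, eval_sub, eval_mul, eval_pow, eval_add, eval_C, eval_X]

/-- For every `t₀` in the interval `(2.65·10³⁹, 3.42·10³⁹)`, the degree-12 polynomial
`h(t₀, x)` has only real roots, i.e. it splits over `ℝ`. -/
theorem totally_real_specializations (t₀ : ℝ)
    (h₁ : 2.65 * 10 ^ 39 < t₀) (h₂ : t₀ < 3.42 * 10 ^ 39) :
    (h t₀).natDegree = 12 ∧ Splits ((h t₀).map (RingHom.id ℝ)) := by
  refine ⟨natDegree_h t₀, ?_⟩
  norm_num at h₁ h₂
  rw [Polynomial.map_id]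
  have e0 : 0 < (h t₀).eval (-100000000000000000000) := by
    rw [eval_h]
    norm_num
    linarith
  have e1 : (h t₀).eval (-4600000000000000000) < 0 := by
    rw [eval_h]
    norm_num
    linarith
  have e2 : 0 < (h t₀).eval (-2000000000000000000) := by
    rw [eval_h]
    norm_num
    linarith
  have e3 : (h t₀).eval (-60700000000000000) < 0 := by
    rw [eval_h]
    norm_num
    linarith
  have e4 : 0 < (h t₀).eval (-59973000000000000) := by
    rw [eval_h]
    norm_num
    linarith
  have e5 : (h t₀).eval (-59930000000000000) < 0 := by
    rw [eval_h]
    norm_num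
    linarith
  have e6 : 0 < (h t₀).eval (-59700000000000000) := by
    rw [eval_h]
    norm_num
    linarith
  have e7 : (h t₀).eval (-59000000000000000) < 0 := by
    rw [eval_h]
    norm_num
    linarith
  have e8 : 0 < (h t₀).eval (-54300000000000000) := by
    rw [eval_h]
    norm_num
    linarith
  have e9 : (h t₀).eval (-20000000000000000) < 0 := by
    rw [eval_h]
    norm_num
    linarith
  have e10 : 0 < (h t₀).eval (94000000000000000) := by
    rw [eval_h]
    norm_num
    linarith
  have e11 : (h t₀).eval (400000000000000000) < 0 := by
    rw [eval_h]
    norm_num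
    linarith
  have e12 : 0 < (h t₀).eval (100000000000000000000) := by
    rw [eval_h]
    norm_num
    linarith
  refine splits_of_alternating 12 _ (natDegree_h t₀)
    ![-100000000000000000000,
      -4600000000000000000,
      -2000000000000000000,
      -60700000000000000,
      -59973000000000000,
      -59930000000000000,
      -59700000000000000,
      -59000000000000000,
      -54300000000000000,
      -20000000000000000,
      94000000000000000,
      400000000000000000,
      100000000000000000000] ?_ ?_
  · intro i
    fin_cases i
    · show (-100000000000000000000 : ℝ) < -4600000000000000000
      norm_num
    · show (-4600000000000000000 : ℝ) < -2000000000000000000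
      norm_num
    · show (-2000000000000000000 : ℝ) < -60700000000000000
      norm_num
    · show (-60700000000000000 : ℝ) < -59973000000000000
      norm_num
    · show (-59973000000000000 : ℝ) < -59930000000000000
      norm_num
    · show (-59930000000000000 : ℝ) < -59700000000000000
      norm_num
    · show (-59700000000000000 : ℝ) < -59000000000000000
      norm_num
    · show (-59000000000000000 : ℝ) < -54300000000000000
      norm_num
    · show (-54300000000000000 : ℝ) < -20000000000000000
      norm_num
    · show (-20000000000000000 : ℝ) < 94000000000000000
      norm_num
    · show (94000000000000000 : ℝ) < 400000000000000000
      norm_num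
    · show (400000000000000000 : ℝ) < 100000000000000000000
      norm_num
  · intro i
    fin_cases i
    · exact mul_neg_of_pos_of_neg e0 e1
    · exact mul_neg_of_neg_of_pos e1 e2
    · exact mul_neg_of_pos_of_neg e2 e3
    · exact mul_neg_of_neg_of_pos e3 e4
    · exact mul_neg_of_pos_of_neg e4 e5
    · exact mul_neg_of_neg_of_pos e5 e6
    · exact mul_neg_of_pos_of_neg e6 e7
    · exact mul_neg_of_neg_of_pos e7 e8
    · exact mul_neg_of_pos_of_neg e8 e9
    · exact mul_neg_of_neg_of_pos e9 e10
    · exact mul_neg_of_pos_of_neg e10 e11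
    · exact mul_neg_of_neg_of_pos e11 e12
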